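/- arXiv:2109.04412 — 6 statements merged into one kernel-verified Lean document; each statement's English description precedes it below -/
import Mathlib

section
/- Let R be a commutative ring and let a, b, c ∈ R satisfy a·b = 0. Then for every natural number n, (a + b + c)^n = (a + c)^n + (b + c)^n − c^n. -/
/-- If `a * b = 0` in a commutative ring, then for every natural number `n`,
`(a + b + c) ^ n = (a + c) ^ n + (b + c) ^ n - c ^ n`. -/
theorem pow_add_add_of_mul_eq_zero {R : Type*} [CommRing R] (a b c : R)
    (hab : a * b = 0) (n : ℕ) :
    (a + b + c) ^ n = (a + c) ^ n + (b + c) ^ n - c ^ n := by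
  induction n with
  | zero => simp
  | succ n ih =>
    obtain ⟨x, hx⟩ := sub_dvd_pow_sub_pow (a + c) c n
    obtain ⟨y, hy⟩ := sub_dvd_pow_sub_pow (b + c) c n
    simp only [pow_succ]
    linear_combination (a + b + c) * ih + b * hx + a * hy + (x + y) * hab
end

section
/- Let S₁, S₂ ⊆ ℝ⁴ be spacelike separated sets, let C⁻ = {z ∈ ℝ⁴ | Q(z) ≥ 0, z₀ ≤ 0} be the past causal cone and C⁺ = {z ∈ ℝ⁴ | Q(z) ≥ 0, z₀ ≥ 0} the future causal cone. Then the Minkowski sum sets S₁ + C⁻ and S₂ + C⁺ are disjoint. -/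
open Pointwise

/-- The Minkowski quadratic form on `ℝ⁴`. -/
def minkowskiQ (x : Fin 4 → ℝ) : ℝ := x 0 ^ 2 - x 1 ^ 2 - x 2 ^ 2 - x 3 ^ 2

/-- Two subsets of Minkowski space are spacelike separated if every point of the
first is at spacelike separation from every point of the second. -/
def SpacelikeSeparatedSets (S₁ S₂ : Set (Fin 4 → ℝ)) : Prop :=
  ∀ x ∈ S₁, ∀ y ∈ S₂, minkowskiQ (x - y) < 0

/-- The future causal cone is closed under addition. -/
theorem minkowskiQ_add_nonneg {a b : Fin 4 → ℝ} (ha : 0 ≤ minkowskiQ a) (ha₀ : 0 ≤ a 0)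
    (hb : 0 ≤ minkowskiQ b) (hb₀ : 0 ≤ b 0) : 0 ≤ minkowskiQ (a + b) := by
  simp only [minkowskiQ, Pi.add_apply] at *
  have cauchy_schwarz : (a 1 * b 1 + a 2 * b 2 + a 3 * b 3) ^ 2 ≤
      (a 1 ^ 2 + a 2 ^ 2 + a 3 ^ 2) * (b 1 ^ 2 + b 2 ^ 2 + b 3 ^ 2) := by
    nlinarith [sq_nonneg (a 1 * b 2 - a 2 * b 1), sq_nonneg (a 1 * b 3 - a 3 * b 1),
      sq_nonneg (a 2 * b 3 - a 3 * b 2)]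
  have norms_le : (a 1 ^ 2 + a 2 ^ 2 + a 3 ^ 2) * (b 1 ^ 2 + b 2 ^ 2 + b 3 ^ 2) ≤
      a 0 ^ 2 * b 0 ^ 2 :=
    mul_le_mul (by linarith) (by linarith) (by positivity) (by positivity)
  have inner_le : a 1 * b 1 + a 2 * b 2 + a 3 * b 3 ≤ a 0 * b 0 :=
    le_of_abs_le (abs_le_of_sq_le_sq (by linarith [mul_pow (a 0) (b 0) 2]) (by positivity))
  linarith

/-- If `S₁` and `S₂` are spacelike separated, then the Minkowski sum of `S₁` with the
past causal cone is disjoint from the Minkowski sum of `S₂` with the future causal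
cone. -/
theorem disjoint_add_pastCone_add_futureCone (S₁ S₂ : Set (Fin 4 → ℝ))
    (h : SpacelikeSeparatedSets S₁ S₂) :
    Disjoint (S₁ + {z : Fin 4 → ℝ | 0 ≤ minkowskiQ z ∧ z 0 ≤ 0})
      (S₂ + {z : Fin 4 → ℝ | 0 ≤ minkowskiQ z ∧ 0 ≤ z 0}) := by
  rw [Set.disjoint_left]
  rintro _ ⟨x, hx, a, ⟨ha, ha₀⟩, rfl⟩ ⟨y, hy, b, ⟨hb, hb₀⟩, hxy⟩
  have neg_a : 0 ≤ minkowskiQ (-a) := by simpa [minkowskiQ] using ha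
  have causal := minkowskiQ_add_nonneg hb hb₀ neg_a (neg_nonneg.mpr ha₀)
  have diff_eq : x - y = b + -a := by
    rw [← sub_eq_add_neg, sub_eq_sub_iff_add_eq_add, add_comm b y]
    exact hxy.symm
  exact (h x hx y hy).not_ge (diff_eq ▸ causal)
end

section
/- Let j₁, j₂, H : ℝ⁴ → ℂ with j₁ and j₂ spacelike separated, and suppose the support of H is contained in the causal cone {z ∈ ℝ⁴ | Q(z) ≥ 0}. Then j₁(x)·(j₂ ⋆ H)(x) = 0 for every x ∈ ℝ⁴. -/
open MeasureTheory

/-- Two functions on Minkowski space are spacelike separated if every point of the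
support of the first is at spacelike separation from every point of the support of
the second. -/
def SpacelikeSeparated (j₁ j₂ : (Fin 4 → ℝ) → ℂ) : Prop :=
  ∀ x ∈ Function.support j₁, ∀ y ∈ Function.support j₂, minkowskiQ (x - y) < 0

/-- Convolution of a source function with a propagator, with respect to Lebesgue
measure on `ℝ⁴`: `(j ⋆ H)(x) = ∫ j(y) H(x − y) dy`. -/
noncomputable def sourceConv (j H : (Fin 4 → ℝ) → ℂ) (x : Fin 4 → ℝ) : ℂ :=
  ∫ y, j y * H (x - y)

/-- If `j₁` and `j₂` are spacelike separated and `H` has support in the causal cone,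
then `j₁ · (j₂ ⋆ H)` vanishes identically. -/
theorem mul_conv_causal_eq_zero (j₁ j₂ H : (Fin 4 → ℝ) → ℂ)
    (hsep : SpacelikeSeparated j₁ j₂)
    (hH : Function.support H ⊆ {z : Fin 4 → ℝ | 0 ≤ minkowskiQ z}) :
    ∀ x, j₁ x * sourceConv j₂ H x = 0 := by
  intro x
  by_cases hx : j₁ x = 0
  · simp [hx]
  · have h : ∀ y, j₂ y * H (x - y) = 0 := by
      intro y
      by_contra hy
      obtain ⟨hy₂, hyH⟩ := mul_ne_zero_iff.mp hy
      exact (hsep x hx y hy₂).not_ge (hH hyH)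
    simp [sourceConv, h]
end

section
/- Let R be a commutative ring, L : R → R an additive map, and a, b, c ∈ R satisfying a·b = 0, a·L(b) = 0, and L(a)·b = 0. Then for every natural number n, (a+b+c)^n · L(a+b+c) = (a+c)^n · L(a+c) + (b+c)^n · L(b+c) − c^n · L(c). -/
theorem add_pow_mul_eq_pow_mul {R : Type*} [CommRing R] {a x : R} (h : a * x = 0) (c : R)
    (n : ℕ) : (a + c) ^ n * x = c ^ n * x := by
  induction n with
  | zero => simp
  | succ n ih =>
    rw [pow_succ, pow_succ]
    linear_combination c * ih + (a + c) ^ n * h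

theorem add_add_pow_of_mul_eq_zero {R : Type*} [CommRing R] {a b : R} (hab : a * b = 0) (c : R)
    (n : ℕ) : (a + b + c) ^ n = (a + c) ^ n + (b + c) ^ n - c ^ n := by
  induction n with
  | zero => simp
  | succ n ih =>
    have ha := add_pow_mul_eq_pow_mul hab c n
    have hb := add_pow_mul_eq_pow_mul ((mul_comm b a).trans hab) c n
    simp only [pow_succ]
    linear_combination (a + b + c) * ih + ha + hb

/-- If `L` is additive and `a·b = a·L(b) = L(a)·b = 0` in a commutative ring, then
`(a+b+c)ⁿ·L(a+b+c) = (a+c)ⁿ·L(a+c) + (b+c)ⁿ·L(b+c) − cⁿ·L(c)`. -/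
theorem pow_mul_additive_weakened_linearity {R : Type*} [CommRing R]
    (L : R → R) (hL : ∀ x y, L (x + y) = L x + L y)
    (a b c : R) (hab : a * b = 0) (haLb : a * L b = 0) (hLab : L a * b = 0) (n : ℕ) :
    (a + b + c) ^ n * L (a + b + c) =
      (a + c) ^ n * L (a + c) + (b + c) ^ n * L (b + c) - c ^ n * L c := by
  have ha : (b + (a + c)) ^ n * L a = (a + c) ^ n * L a :=
    add_pow_mul_eq_pow_mul ((mul_comm b (L a)).trans hLab) (a + c) n
  have hb : (a + (b + c)) ^ n * L b = (b + c) ^ n * L b :=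
    add_pow_mul_eq_pow_mul haLb (b + c) n
  rw [show b + (a + c) = a + b + c by ring] at ha
  rw [← add_assoc] at hb
  simp only [hL]
  linear_combination ha + hb + L c * add_add_pow_of_mul_eq_zero hab c n
end

section
/- Let R be a commutative ring, L₁, L₂ : R → R additive maps, and a, b, c ∈ R satisfying a·b = 0, a·L₁(b) = 0, a·L₂(b) = 0, L₁(a)·b = 0, L₂(a)·b = 0, L₁(a)·L₂(b) = 0, and L₂(a)·L₁(b) = 0. Then for every natural number n, (a+b+c)^n · L₁(a+b+c) · L₂(a+b+c) = (a+c)^n · L₁(a+c) · L₂(a+c) + (b+c)^n · L₁(b+c) · L₂(b+c) − c^n · L₁(c) · L₂(c). -/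
/-- If `a * b = 0`, the powers of `a + c`, `b + c` and `a + b + c` differ from those of `c` by
compatible multiples of `a` and `b`. -/
theorem exists_add_pow_eq_of_mul_eq_zero {R : Type*} [CommRing R] {a b : R} (hab : a * b = 0)
    (c : R) (n : ℕ) :
    ∃ p q : R, (a + c) ^ n = c ^ n + a * p ∧ (b + c) ^ n = c ^ n + b * q ∧
      (a + b + c) ^ n = c ^ n + a * p + b * q := by
  induction n with
  | zero => exact ⟨0, 0, by simp⟩
  | succ n ih =>
    obtain ⟨p, q, ha, hb, h⟩ := ih
    refine ⟨c ^ n + (a + c) * p, c ^ n + (b + c) * q, ?_, ?_, ?_⟩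
    · rw [pow_succ, ha]
      ring
    · rw [pow_succ, hb]
      ring
    · rw [pow_succ, h]
      linear_combination (p + q) * hab

/-- If `L₁`, `L₂` are additive and all seven cross products
`a·b`, `a·L₁(b)`, `a·L₂(b)`, `L₁(a)·b`, `L₂(a)·b`, `L₁(a)·L₂(b)`, `L₂(a)·L₁(b)`
vanish in a commutative ring, then
`(a+b+c)ⁿ·L₁(a+b+c)·L₂(a+b+c) = (a+c)ⁿ·L₁(a+c)·L₂(a+c) + (b+c)ⁿ·L₁(b+c)·L₂(b+c) − cⁿ·L₁(c)·L₂(c)`. -/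
theorem pow_mul_additive_additive_weakened_linearity {R : Type*} [CommRing R]
    (L₁ L₂ : R → R) (hL₁ : ∀ x y, L₁ (x + y) = L₁ x + L₁ y)
    (hL₂ : ∀ x y, L₂ (x + y) = L₂ x + L₂ y)
    (a b c : R) (hab : a * b = 0)
    (haL₁b : a * L₁ b = 0) (haL₂b : a * L₂ b = 0)
    (hL₁ab : L₁ a * b = 0) (hL₂ab : L₂ a * b = 0)
    (hL₁aL₂b : L₁ a * L₂ b = 0) (hL₂aL₁b : L₂ a * L₁ b = 0) (n : ℕ) :
    (a + b + c) ^ n * L₁ (a + b + c) * L₂ (a + b + c) =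
      (a + c) ^ n * L₁ (a + c) * L₂ (a + c) +
        (b + c) ^ n * L₁ (b + c) * L₂ (b + c) - c ^ n * L₁ c * L₂ c := by
  obtain ⟨p, q, hac, hbc, habc⟩ := exists_add_pow_eq_of_mul_eq_zero hab c n
  rw [hac, hbc, habc]
  simp only [hL₁, hL₂]
  linear_combination c ^ n * hL₁aL₂b + c ^ n * hL₂aL₁b
    + p * (L₂ a + L₂ b + L₂ c) * haL₁b + p * (L₁ a + L₁ c) * haL₂b
    + q * (L₂ a + L₂ b + L₂ c) * hL₁ab + q * (L₁ b + L₁ c) * hL₂ab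
end

section
/- Let j₁, j₂, j₃ : ℝ⁴ → ℂ be continuous with compact support and let H : ℝ⁴ → ℂ be locally integrable with support contained in the causal cone {z ∈ ℝ⁴ | Q(z) ≥ 0}. Suppose j₁ and j₂ are spacelike separated. Then for F[j] = jⁿ·(j ⋆ H) (pointwise product of the n-th power of j with the convolution j ⋆ H) and every natural number n, F[j₁+j₂+j₃](x) = F[j₁+j₃](x) + F[j₂+j₃](x) − F[j₃](x) for all x ∈ ℝ⁴. -/
open MeasureTheory

theorem minkowskiQ_sub_comm (x y : Fin 4 → ℝ) : minkowskiQ (x - y) = minkowskiQ (y - x) := by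
  simp only [minkowskiQ, Pi.sub_apply]
  ring

theorem SpacelikeSeparated.symm {j₁ j₂ : (Fin 4 → ℝ) → ℂ} (h : SpacelikeSeparated j₁ j₂) :
    SpacelikeSeparated j₂ j₁ := fun x hx y hy ↦ by
  rw [minkowskiQ_sub_comm]
  exact h y hy x hx

theorem SpacelikeSeparated.eq_zero {j₁ j₂ : (Fin 4 → ℝ) → ℂ} (h : SpacelikeSeparated j₁ j₂)
    {x : Fin 4 → ℝ} (hx : j₁ x ≠ 0) : j₂ x = 0 := by
  by_contra hx'
  simpa [minkowskiQ] using h x hx x hx'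

/-- A source has no causal influence on points at which a spacelike separated source is
nonzero. -/
theorem SpacelikeSeparated.sourceConv_eq_zero {j₁ j₂ H : (Fin 4 → ℝ) → ℂ}
    (h : SpacelikeSeparated j₁ j₂)
    (hH : Function.support H ⊆ {z : Fin 4 → ℝ | 0 ≤ minkowskiQ z})
    {x : Fin 4 → ℝ} (hx : j₁ x ≠ 0) : sourceConv j₂ H x = 0 := by
  have hzero (y : Fin 4 → ℝ) : j₂ y * H (x - y) = 0 := by
    by_contra hy
    obtain ⟨hy₁, hy₂⟩ := mul_ne_zero_iff.mp hy
    exact (h x hx y hy₁).not_ge (hH hy₂)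
  simp [sourceConv, hzero]

theorem integrable_mul_comp_sub {j H : (Fin 4 → ℝ) → ℂ} (hc : Continuous j)
    (hs : HasCompactSupport j) (hH : LocallyIntegrable H) (x : Fin 4 → ℝ) :
    Integrable fun y ↦ j y * H (x - y) :=
  hs.convolutionExists_left (ContinuousLinearMap.mul ℝ ℂ) hc hH x

theorem sourceConv_add {j k H : (Fin 4 → ℝ) → ℂ} (hjc : Continuous j)
    (hjs : HasCompactSupport j) (hkc : Continuous k) (hks : HasCompactSupport k)
    (hH : LocallyIntegrable H) (x : Fin 4 → ℝ) :
    sourceConv (j + k) H x = sourceConv j H x + sourceConv k H x := by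
  simp only [sourceConv, Pi.add_apply, add_mul]
  exact integral_add (integrable_mul_comp_sub hjc hjs hH x) (integrable_mul_comp_sub hkc hks hH x)

/-- The source functional `F[j] = jⁿ·(j ⋆ H)` satisfies the weakened-linearity axiom
`F[j₁+j₂+j₃] = F[j₁+j₃] + F[j₂+j₃] − F[j₃]` pointwise, when `j₁` and `j₂` are
spacelike separated and `H` is locally integrable with support in the causal cone. -/
theorem pow_mul_conv_weakened_linearity (j₁ j₂ j₃ H : (Fin 4 → ℝ) → ℂ)
    (hj₁c : Continuous j₁) (hj₁s : HasCompactSupport j₁)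
    (hj₂c : Continuous j₂) (hj₂s : HasCompactSupport j₂)
    (hj₃c : Continuous j₃) (hj₃s : HasCompactSupport j₃)
    (hH : LocallyIntegrable H)
    (hHsupp : Function.support H ⊆ {z : Fin 4 → ℝ | 0 ≤ minkowskiQ z})
    (hsep : SpacelikeSeparated j₁ j₂) (n : ℕ) :
    ∀ x : Fin 4 → ℝ,
      (j₁ x + j₂ x + j₃ x) ^ n * sourceConv (j₁ + j₂ + j₃) H x =
        (j₁ x + j₃ x) ^ n * sourceConv (j₁ + j₃) H x +
          (j₂ x + j₃ x) ^ n * sourceConv (j₂ + j₃) H x -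
            j₃ x ^ n * sourceConv j₃ H x := by
  intro x
  rw [sourceConv_add (hj₁c.add hj₂c) (hj₁s.add hj₂s) hj₃c hj₃s hH,
    sourceConv_add hj₁c hj₁s hj₂c hj₂s hH, sourceConv_add hj₁c hj₁s hj₃c hj₃s hH,
    sourceConv_add hj₂c hj₂s hj₃c hj₃s hH]
  by_cases h₁ : j₁ x = 0
  · by_cases h₂ : j₂ x = 0
    · simp only [h₁, h₂, zero_add]
      ring
    · simp only [h₁, hsep.symm.sourceConv_eq_zero hHsupp h₂, zero_add]
      ring
  · simp only [hsep.eq_zero h₁, hsep.sourceConv_eq_zero hHsupp h₁, zero_add, add_zero]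
    ring
end
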